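/- Extension preserves value typing: If μ2 extends μ1, then (1) ⊢_{Δ,μ_init,μ1} W : τ implies ⊢_{Δ,μ_init,μ2} W : τ; (2) ⊢_{Δ,μ_init,μ1} W̄ : τ # m implies ⊢_{Δ,μ_init,μ2} W̄ : τ # m; (3) ⊢_{Δ,μ_init,μ1} Ω : Γ implies ⊢_{Δ,μ_init,μ2} Ω : Γ; and (4) ⊢_{Δ,μ1} V̄ : T # m implies ⊢_{Δ,μ2} V̄ : T # m. -/

import Mathlib

/-! # A core graph-relational calculus (EdgeQL core)

Formalization of the graph-relational database model: cardinality modes,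
schemas, database stores, expressions, static semantics (typing), and
big-step dynamic semantics (evaluation). -/

/-! ## Cardinality modes -/

/-- A cardinality mode `[lo, hi]` with `lo ∈ {0,1} ⊆ ℕ`, `hi ∈ {0,1,∞} ⊆ ℕ∞`, and `lo ≤ hi`. -/
@[ext]
structure Card where
  lo : ℕ
  hi : ℕ∞
  lo_mem : lo = 0 ∨ lo = 1
  hi_mem : hi = 0 ∨ hi = 1 ∨ hi = ⊤
  lo_le_hi : (lo : ℕ∞) ≤ hi

namespace Card

/-- A natural number `n` lies in the cardinality mode `m` iff `m.lo ≤ n` and `n ≤ m.hi`. -/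
instance : Membership ℕ Card := ⟨fun m n => m.lo ≤ n ∧ (n : ℕ∞) ≤ m.hi⟩

theorem mem_def {n : ℕ} {m : Card} : n ∈ m ↔ m.lo ≤ n ∧ (n : ℕ∞) ≤ m.hi := Iff.rfl

/-- The order on cardinality modes: `[i1,i2] ≤ [i3,i4]` iff `i3 ≤ i1` and `i2 ≤ i4`. -/
instance : LE Card := ⟨fun a b => b.lo ≤ a.lo ∧ a.hi ≤ b.hi⟩

theorem le_def {a b : Card} : a ≤ b ↔ b.lo ≤ a.lo ∧ a.hi ≤ b.hi := Iff.rfl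

/-- The empty mode `[0,0]`. -/
def zero : Card := ⟨0, 0, Or.inl rfl, Or.inl rfl, le_refl _⟩
/-- The required-single mode `[1,1]`. -/
def one : Card := ⟨1, 1, Or.inr rfl, Or.inr (Or.inl rfl), le_refl _⟩
/-- The optional-single mode `[0,1]`. -/
def opt : Card := ⟨0, 1, Or.inl rfl, Or.inr (Or.inl rfl), by simp⟩
/-- The optional-multi mode `[0,∞]`. -/
def many : Card := ⟨0, ⊤, Or.inl rfl, Or.inr (Or.inr rfl), by simp⟩
/-- The required-multi mode `[1,∞]`. -/
def oneMany : Card := ⟨1, ⊤, Or.inr rfl, Or.inr (Or.inr rfl), by simp⟩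

/-- Addition of cardinality modes:
`[i1,i2] + [i3,i4] = [min 1 (i1+i3), round (i2+i4)]` where `round k = k` for `k ≤ 1` else `∞`. -/
def add (a b : Card) : Card where
  lo := min 1 (a.lo + b.lo)
  hi := if a.hi + b.hi ≤ 1 then a.hi + b.hi else ⊤
  lo_mem := by omega
  hi_mem := by
    rcases a.hi_mem with h1 | h1 | h1 <;> rcases b.hi_mem with h2 | h2 | h2 <;>
      simp [h1, h2] <;> norm_num
  lo_le_hi := by
    rcases a.lo_mem with hl1 | hl1 <;> rcases b.lo_mem with hl2 | hl2 <;>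
    rcases a.hi_mem with h1 | h1 | h1 <;> rcases b.hi_mem with h2 | h2 | h2 <;>
    · have := a.lo_le_hi
      have := b.lo_le_hi
      simp_all <;> norm_num

/-- Multiplication of cardinality modes: `[i1,i2] × [i3,i4] = [i1·i3, i2·i4]`. -/
def mul (a b : Card) : Card where
  lo := a.lo * b.lo
  hi := a.hi * b.hi
  lo_mem := by rcases a.lo_mem with h1 | h1 <;> rcases b.lo_mem with h2 | h2 <;> simp [h1, h2]
  hi_mem := by
    rcases a.hi_mem with h1 | h1 | h1 <;> rcases b.hi_mem with h2 | h2 | h2 <;>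
      simp [h1, h2]
  lo_le_hi := by
    calc ((a.lo * b.lo : ℕ) : ℕ∞) = (a.lo : ℕ∞) * (b.lo : ℕ∞) := by push_cast; ring
    _ ≤ a.hi * b.hi := mul_le_mul' a.lo_le_hi b.lo_le_hi

/-- The join of cardinality modes, `[min lo lo', max hi hi']`, used in typing conditionals. -/
noncomputable def join (a b : Card) : Card where
  lo := min a.lo b.lo
  hi := max a.hi b.hi
  lo_mem := by
    rcases a.lo_mem with h1 | h1 <;> rcases b.lo_mem with h2 | h2 <;> simp [h1, h2]
  hi_mem := by
    rcases a.hi_mem with h1 | h1 | h1 <;> rcases b.hi_mem with h2 | h2 | h2 <;>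
      simp [h1, h2]
  lo_le_hi := by
    calc ((min a.lo b.lo : ℕ) : ℕ∞) ≤ (a.lo : ℕ∞) := by
          exact_mod_cast Nat.cast_le.mpr (min_le_left _ _)
    _ ≤ a.hi := a.lo_le_hi
    _ ≤ max a.hi b.hi := le_max_left _ _

instance : Add Card := ⟨add⟩
instance : Mul Card := ⟨mul⟩
instance : Zero Card := ⟨zero⟩
instance : One Card := ⟨one⟩

end Card

/-! ## Basic syntax -/

/-- Labels. -/
abbrev Label := ℕ
/-- Type names. -/
abbrev TyName := ℕ
/-- Unique identifiers. -/
abbrev Ident := ℕ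
/-- Expression variables. -/
abbrev Var := ℕ

/-- Scalar types (int, str, bool). -/
inductive ScalarTy where
  | int | str | bool
deriving DecidableEq

/-- Scalar values. -/
inductive ScalarVal where
  | vint : ℤ → ScalarVal
  | vstr : String → ScalarVal
  | vbool : Bool → ScalarVal
deriving DecidableEq

/-- The primitive typing of scalar values: each scalar value has exactly one scalar type. -/
def ScalarVal.ty : ScalarVal → ScalarTy
  | .vint _ => .int
  | .vstr _ => .str
  | .vbool _ => .bool

/-- Stored value types: a scalar type `t` or a reference type
`N⟨L1:t1#m1,…,Ln:tn#mn⟩` (mapping link-property labels to scalar types and modes). -/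
inductive StoredTy where
  | scalar : ScalarTy → StoredTy
  | ref : TyName → List (Label × ScalarTy × Card) → StoredTy

/-- Stored values: a scalar value or a reference value `id⟨L1≔v̄1,…,Ln≔v̄n⟩`
mapping link-property labels to sequences of scalar values. -/
inductive StoredVal where
  | scalar : ScalarVal → StoredVal
  | ref : Ident → List (Label × List ScalarVal) → StoredVal
deriving DecidableEq

/-- Computed types `τ`: a scalar type or `N⟨L1:τ1#m1,…,Ln:τn#mn⟩`. -/
inductive Ty where
  | scalar : ScalarTy → Ty
  | ref : TyName → List (Label × Ty × Card) → Ty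

/-- Record entry visibility marks. -/
inductive Visibility where
  | visible | invisible
deriving DecidableEq

/-- Computed values `W`: a scalar value, or a reference value mapping distinct labels to
sequences of computed values, each entry carrying a visibility mark. -/
inductive Value where
  | scalar : ScalarVal → Value
  | ref : Ident → List (Label × Visibility × List Value) → Value

/-- The evident inclusion of stored value types into computed types. -/
def StoredTy.toTy : StoredTy → Ty
  | .scalar t => .scalar t
  | .ref N lps => .ref N (lps.map fun p => (p.1, Ty.scalar p.2.1, p.2.2))

/-- The evident inclusion of stored values into computed values. -/
def StoredVal.toValue : StoredVal → Value
  | .scalar v => .scalar v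
  | .ref i entries => .ref i (entries.map fun p => (p.1, Visibility.invisible, p.2.map Value.scalar))

/-! ## Schemas -/

/-- A schema `Δ` is a finite partial map from type names to object types
`⟨L1:T1#m1,…,Ln:Tn#mn⟩`. -/
abbrev Schema := List (TyName × List (Label × StoredTy × Card))

/-- `L` is an object label of `Δ`: it occurs at the top level of some object type of `Δ`. -/
def IsObjLabel (Δ : Schema) (L : Label) : Prop :=
  ∃ p ∈ Δ, ∃ f ∈ p.2, f.1 = L

/-- `L` is a link-property label of `Δ`: it occurs inside a reference type in `Δ`. -/
def IsLinkPropLabel (Δ : Schema) (L : Label) : Prop :=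
  ∃ p ∈ Δ, ∃ f ∈ p.2, ∃ N' lps, f.2.1 = StoredTy.ref N' lps ∧ ∃ q ∈ lps, q.1 = L

/-- `⊢ Δ ok`: each type name has at most one definition, every type name occurring in the
range of `Δ` is in its domain, and the labels of `Δ` partition into object labels and
link-property labels. -/
def SchemaOk (Δ : Schema) : Prop :=
  (Δ.map Prod.fst).Nodup ∧
  (∀ p ∈ Δ, ∀ f ∈ p.2, ∀ N' lps, f.2.1 = StoredTy.ref N' lps → ∃ fs, Δ.lookup N' = some fs) ∧
  (∀ L, ¬ (IsObjLabel Δ L ∧ IsLinkPropLabel Δ L))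

/-! ## Database stores -/

/-- Edit marks. -/
inductive EditMark where
  | unlocked | locked
deriving DecidableEq

/-- A database-store tuple `(id, N, κ, ⟨L1≔V̄1,…,Ln≔V̄n⟩)`. -/
abbrev Row := Ident × TyName × EditMark × List (Label × List StoredVal)

instance : DecidableEq Row :=
  have : DecidableEq (EditMark × List (Label × List StoredVal)) := inferInstance
  have : DecidableEq (TyName × EditMark × List (Label × List StoredVal)) := instDecidableEqProd
  instDecidableEqProd

/-- A database store: a finite set of tuples with each identifier occurring in at most
one tuple. -/
structure Store where
  rows : Finset Row
  uniq : ∀ r ∈ rows, ∀ r' ∈ rows, r.1 = r'.1 → r = r'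

instance : Membership Row Store := ⟨fun μ r => r ∈ μ.rows⟩

theorem Store.mem_def {μ : Store} {r : Row} : r ∈ μ ↔ r ∈ μ.rows := Iff.rfl

/-- `μ'` extends `μ`: every tuple of `μ` has a corresponding tuple of `μ'` with the same
identifier and type name, and every tuple of `μ'` with an unlocked edit mark occurs,
unchanged, in `μ`. -/
def Store.Extends (μ' μ : Store) : Prop :=
  (∀ r ∈ μ, ∃ r' ∈ μ', r'.1 = r.1 ∧ r'.2.1 = r.2.1) ∧
  (∀ r ∈ μ', r.2.2.1 = EditMark.unlocked → r ∈ μ)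
/-! ## Expressions -/

/-- Parameter modifiers for built-in functions. -/
inductive Param where
  | one | opt | many
deriving DecidableEq

/-- The cardinality mode denoted by a parameter modifier:
`⟦one⟧ = [1,1]`, `⟦opt⟧ = [0,1]`, `⟦many⟧ = [0,∞]`. -/
def Param.card : Param → Card
  | .one => Card.one
  | .opt => Card.opt
  | .many => Card.many

/-- Built-in functions. -/
inductive Fn where
  | count | eq | any
deriving DecidableEq

/-- Expressions. -/
inductive Expr where
  | var : Var → Expr
  | prim : ScalarVal → Expr
  | empty : Ty → Expr
  | union : Expr → Expr → Expr
  | name : TyName → Expr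
  | proj : Expr → Label → Expr
  | backlink : Expr → Label → TyName → Expr
  | shaping : Expr → Var → List (Label × Expr) → Expr
  | app : Fn → List Expr → Expr
  | ite : Expr → Expr → Expr → Expr
  | withE : Expr → Var → Expr → Expr
  | forE : Expr → Var → Expr → Expr
  | orderby : Expr → Var → Expr → Expr
  | insert : TyName → List (Label × Expr) → Expr
  | update : Expr → Var → List (Label × Expr) → Expr

/-- Typing contexts: a type and cardinality mode for each of finitely many variables. -/
abbrev Ctx := List (Var × Ty × Card)

/-- Built-in function signatures `f : (τ1#p1,…,τn#pn) → τ'#m'`; the signature is uniquely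
determined by `f` and the argument types. -/
inductive FnSig : Fn → List (Ty × Param) → Ty → Card → Prop where
  | count {τ : Ty} : FnSig .count [(τ, .many)] (Ty.scalar .int) Card.one
  | eq {τ : Ty} : FnSig .eq [(τ, .one), (τ, .one)] (Ty.scalar .bool) Card.one
  | any : FnSig .any [(Ty.scalar .bool, .many)] (Ty.scalar .bool) Card.one

/-- Record extension on object types (right-biased). -/
def Ty.extend : Ty → List (Label × Ty × Card) → Ty
  | .scalar t, _ => .scalar t
  | .ref N fields, new =>
      .ref N ((fields.filter fun f => decide (f.1 ∉ new.map Prod.fst)) ++ new)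

/-! ## Static semantics -/

mutual
/-- The typing judgment `Γ ⊢_Δ e : τ # m`. -/
inductive Typed : Schema → Ctx → Expr → Ty → Card → Prop where
  | var {Δ : Schema} {Γ : Ctx} {x τ m} :
      Γ.lookup x = some (τ, m) → Typed Δ Γ (.var x) τ m
  | prim {Δ Γ v} : Typed Δ Γ (.prim v) (Ty.scalar v.ty) Card.one
  | emp {Δ Γ τ} : Typed Δ Γ (.empty τ) τ Card.zero
  | union {Δ Γ e₁ e₂ τ m₁ m₂} :
      Typed Δ Γ e₁ τ m₁ → Typed Δ Γ e₂ τ m₂ →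
      Typed Δ Γ (.union e₁ e₂) τ (Card.add m₁ m₂)
  | name {Δ : Schema} {Γ N fs} :
      Δ.lookup N = some fs → Typed Δ Γ (.name N) (Ty.ref N []) Card.many
  | proj_db {Δ : Schema} {Γ e N fields m' L sfields T m} :
      Typed Δ Γ e (Ty.ref N fields) m' →
      L ∉ fields.map (fun f => f.1) →
      Δ.lookup N = some sfields → (L, T, m) ∈ sfields →
      Typed Δ Γ (.proj e L) T.toTy (Card.mul m m')
  | proj_ext {Δ Γ e N fields m' L τ m} :
      Typed Δ Γ e (Ty.ref N fields) m' →
      (L, τ, m) ∈ fields →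
      Typed Δ Γ (.proj e L) τ (Card.mul m m')
  | backlink {Δ : Schema} {Γ e N sfields L N' lps m fields m'} :
      Δ.lookup N = some sfields → (L, StoredTy.ref N' lps, m) ∈ sfields →
      Typed Δ Γ e (Ty.ref N' fields) m' →
      Typed Δ Γ (.backlink e L N)
        (Ty.ref N (lps.map fun p => (p.1, Ty.scalar p.2.1, p.2.2))) Card.many
  | shaping {Δ Γ e N fields m x ents tms} :
      Typed Δ Γ e (Ty.ref N fields) m →
      ents.length = tms.length →
      (∀ p ∈ ents.zip tms,
        Typed Δ ((x, Ty.ref N fields, Card.one) :: Γ) p.1.2 p.2.1 p.2.2) →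
      Typed Δ Γ (.shaping e x ents)
        ((Ty.ref N fields).extend
          (List.zipWith (fun (en : Label × Expr) (tm : Ty × Card) => (en.1, tm.1, tm.2)) ents tms))
        m
  | app {Δ Γ f es tps ms τ' m'} :
      FnSig f tps τ' m' →
      es.length = tps.length → es.length = ms.length →
      (∀ p ∈ (es.zip tps).zip ms, Typed Δ Γ p.1.1 p.1.2.1 p.2) →
      (∀ p ∈ tps.zip ms, p.2 ≤ p.1.2.card) →
      Typed Δ Γ (.app f es) τ' m'
  | ite {Δ Γ e et ef τ mt mf} :
      Typed Δ Γ e (Ty.scalar .bool) Card.one →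
      Typed Δ Γ et τ mt → Typed Δ Γ ef τ mf →
      Typed Δ Γ (.ite e et ef) τ (Card.join mt mf)
  | withE {Δ Γ e₁ τ₁ m₁ x e₂ τ₂ m₂} :
      Typed Δ Γ e₁ τ₁ m₁ →
      Typed Δ ((x, τ₁, m₁) :: Γ) e₂ τ₂ m₂ →
      Typed Δ Γ (.withE e₁ x e₂) τ₂ m₂
  | forE {Δ Γ e₁ τ₁ m₁ x e₂ τ₂ m₂} :
      Typed Δ Γ e₁ τ₁ m₁ →
      Typed Δ ((x, τ₁, Card.one) :: Γ) e₂ τ₂ m₂ →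
      Typed Δ Γ (.forE e₁ x e₂) τ₂ (Card.mul m₁ m₂)
  | orderby {Δ Γ e₁ τ₁ m x e₂ τ₂} :
      Typed Δ Γ e₁ τ₁ m →
      Typed Δ ((x, τ₁, Card.one) :: Γ) e₂ τ₂ Card.opt →
      Typed Δ Γ (.orderby e₁ x e₂) τ₁ m
  | insert {Δ : Schema} {Γ N sfields ents taus} :
      Δ.lookup N = some sfields →
      ents.map Prod.fst = sfields.map (fun f => f.1) →
      ents.length = taus.length →
      (∀ p ∈ ents.zip (sfields.zip taus),
        TypedStore Δ Γ p.1.2 p.2.2 p.2.1.2.1 p.2.1.2.2) →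
      Typed Δ Γ (.insert N ents)
        (Ty.ref N (List.zipWith
          (fun (f : Label × StoredTy × Card) (τ : Ty) => (f.1, τ, f.2.2)) sfields taus))
        Card.one
  | update {Δ : Schema} {Γ e N fields x ents tms taus sfields} :
      Typed Δ Γ e (Ty.ref N fields) Card.one →
      Δ.lookup N = some sfields →
      ents.length = tms.length → ents.length = taus.length →
      (∀ p ∈ ents.zip tms, ((p.1.1, p.2.1, p.2.2) : Label × StoredTy × Card) ∈ sfields) →
      (∀ p ∈ (ents.zip tms).zip taus,
        TypedStore Δ ((x, Ty.ref N fields, Card.one) :: Γ) p.1.1.2 p.2 p.1.2.1 p.1.2.2) →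
      Typed Δ Γ (.update e x ents)
        (Ty.ref N (List.zipWith
          (fun (en : Label × Expr) (p : (StoredTy × Card) × Ty) => (en.1, p.2, p.1.2))
          ents (tms.zip taus)))
        Card.opt

/-- The auxiliary typing judgment `Γ ⊢_Δ e ÷ τ/T # m` checking an expression against a
stored value type and mode from the schema. -/
inductive TypedStore : Schema → Ctx → Expr → Ty → StoredTy → Card → Prop where
  | simple {Δ Γ e t m' m} :
      Typed Δ Γ e (Ty.scalar t) m' → m' ≤ m →
      TypedStore Δ Γ e (Ty.scalar t) (StoredTy.scalar t) m
  | ref {Δ Γ e N fields m' m lps} :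
      Typed Δ Γ e (Ty.ref N fields) m' → m' ≤ m →
      (∀ p ∈ lps, ∃ m'', ((p.1, Ty.scalar p.2.1, m'') : Label × Ty × Card) ∈ fields ∧ m'' ≤ p.2.2) →
      TypedStore Δ Γ e (Ty.ref N fields) (StoredTy.ref N lps) m
end
/-! ## Stored-value typing and well-formed stores -/

/-- A sequence of scalar values has scalar type `t` and mode `m`. -/
def ScalarSeqTyped (svs : List ScalarVal) (t : ScalarTy) (m : Card) : Prop :=
  (∀ v ∈ svs, v.ty = t) ∧ m.lo ≤ svs.length ∧ (svs.length : ℕ∞) ≤ m.hi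

/-- Stored-value typing `⊢_{Δ,μ} V : T` (rules ST-prim and ST-ref). -/
inductive STyped : Schema → Store → StoredVal → StoredTy → Prop where
  | prim {Δ μ v} : STyped Δ μ (.scalar v) (StoredTy.scalar v.ty)
  | ref {Δ : Schema} {μ : Store} {i N κ fields entries lps} :
      ((i, N, κ, fields) : Row) ∈ μ →
      entries.length = lps.length →
      (∀ p ∈ entries.zip lps, p.1.1 = p.2.1 ∧ ScalarSeqTyped p.1.2 p.2.2.1 p.2.2.2) →
      STyped Δ μ (.ref i entries) (.ref N lps)

/-- Stored-value sequence typing `⊢_{Δ,μ} V̄ : T # m` (rule ST-set). -/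
def STypedSeq (Δ : Schema) (μ : Store) (vs : List StoredVal) (T : StoredTy) (m : Card) : Prop :=
  m.lo ≤ vs.length ∧ (vs.length : ℕ∞) ≤ m.hi ∧ ∀ v ∈ vs, STyped Δ μ v T

/-- `⊢_Δ μ ok`: the schema is well-formed and each tuple's record is well-typed at the
object type the schema assigns to its type name. -/
def StoreOk (Δ : Schema) (μ : Store) : Prop :=
  SchemaOk Δ ∧
  ∀ r ∈ μ, ∃ sfields, Δ.lookup r.2.1 = some sfields ∧
    r.2.2.2.length = sfields.length ∧
    (∀ p ∈ r.2.2.2.zip sfields, p.1.1 = p.2.1 ∧ STypedSeq Δ μ p.1.2 p.2.2.1 p.2.2.2)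

/-! ## Computed-value typing -/

mutual
/-- Computed-value typing `⊢_{Δ,μ_init,μ} W : τ`
(rules VT-prim, VT-stored-ref, VT-new-ref). -/
inductive VTyped : Schema → Store → Store → Value → Ty → Prop where
  | prim {Δ μi μ v} : VTyped Δ μi μ (.scalar v) (Ty.scalar v.ty)
  | storedRef {Δ : Schema} {μi μ : Store} {i N κ fields entries tfields} :
      ((i, N, κ, fields) : Row) ∈ μi →
      entries.length = tfields.length →
      (∀ p ∈ entries.zip tfields, p.1.1 = p.2.1) →
      (∀ p ∈ entries.zip tfields, VTypedSeq Δ μi μ p.1.2.2 p.2.2.1 p.2.2.2) →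
      VTyped Δ μi μ (.ref i entries) (.ref N tfields)
  | newRef {Δ : Schema} {μi μ : Store} {i N sfields κfields entries tfields} :
      Δ.lookup N = some sfields →
      (∀ f ∈ sfields, f.1 ∈ entries.map Prod.fst) →
      ((i, N, EditMark.locked, κfields) : Row) ∈ μ →
      entries.length = tfields.length →
      (∀ p ∈ entries.zip tfields, p.1.1 = p.2.1) →
      (∀ p ∈ entries.zip tfields, VTypedSeq Δ μi μ p.1.2.2 p.2.2.1 p.2.2.2) →
      VTyped Δ μi μ (.ref i entries) (.ref N tfields)

/-- Computed-value sequence typing `⊢_{Δ,μ_init,μ} W̄ : τ # m` (rule VT-set). -/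
inductive VTypedSeq : Schema → Store → Store → List Value → Ty → Card → Prop where
  | set {Δ μi μ ws τ} {m : Card} :
      m.lo ≤ ws.length → (ws.length : ℕ∞) ≤ m.hi →
      (∀ w ∈ ws, VTyped Δ μi μ w τ) →
      VTypedSeq Δ μi μ ws τ m
end

/-! ## Environments -/

/-- Environments mapping variables to computed-value sequences. -/
abbrev Env := List (Var × List Value)

/-- Environment typing `⊢_{Δ,μ_init,μ} Ω : Γ`: `Ω` and `Γ` bind the same variables, and
each binding is well-typed. -/
def EnvTyped (Δ : Schema) (μi μ : Store) (Ω : Env) (Γ : Ctx) : Prop :=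
  (∀ x, (Ω.lookup x).isSome ↔ (Γ.lookup x).isSome) ∧
  (∀ x ws τ m, Ω.lookup x = some ws → Γ.lookup x = some (τ, m) →
    VTypedSeq Δ μi μ ws τ m)

/-! ## Storage stripping -/

/-- The storage-stripping judgment `W : T ▷ V` (rules ES-simple and ES-reference): strips
a computed value down to the stored value retaining exactly the scalar entries at the
labels of the target reference type. -/
inductive Strip : Value → StoredTy → StoredVal → Prop where
  | simple {v t} : Strip (.scalar v) (.scalar t) (.scalar v)
  | ref {i entries N lps outs} :
      lps.length = outs.length →
      (∀ p ∈ lps.zip outs, ∃ (vis : Visibility) (svs : List ScalarVal),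
        ((p.1.1, vis, svs.map Value.scalar) : Label × Visibility × List Value) ∈ entries ∧
        p.2 = (p.1.1, svs)) →
      Strip (.ref i entries) (.ref N lps) (.ref i outs)

/-- The storage-stripping judgment `W̄ : T ▷ V̄` (rule ES-sequence), pointwise. -/
def StripSeq (ws : List Value) (T : StoredTy) (vs : List StoredVal) : Prop :=
  List.Forall₂ (fun w v => Strip w T v) ws vs
/-! ## Dynamic semantics: auxiliary operations -/

/-- Right-biased record extension on computed values `W ⊎ R`: entries carried over from
the original value are marked invisible, new entries are visible. -/
def Value.extend : Value → List (Label × List Value) → Value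
  | .scalar v, _ => .scalar v
  | .ref i entries, new =>
      .ref i
        (((entries.filter fun en => decide (en.1 ∉ new.map Prod.fst)).map
            fun en => (en.1, Visibility.invisible, en.2.2)) ++
          new.map fun p => (p.1, Visibility.visible, p.2))

/-- The (partial) projection operation `project(μ, L, W)` as a relation: project the
internally stored sequence at `L` if present, else look the value's identifier up in the
store `μ`. -/
inductive Project : Store → Label → Value → List Value → Prop where
  | ext {μ L i entries vis ws} :
      ((L, vis, ws) : Label × Visibility × List Value) ∈ entries →
      Project μ L (.ref i entries) ws
  | db {μ : Store} {L i entries N κ fields vs} :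
      (∀ p ∈ entries, p.1 ≠ L) →
      ((i, N, κ, fields) : Row) ∈ μ →
      ((L, vs) : Label × List StoredVal) ∈ fields →
      Project μ L (.ref i entries) (vs.map StoredVal.toValue)

/-- `w` is one of the results of `seek(μ, N, L, id)`: a reference to a tuple of type `N`
whose `L` field contains a stored reference to `id`, carrying that reference's
link properties. -/
def SeekMatches (μ : Store) (N : TyName) (L : Label) (i : Ident) (w : Value) : Prop :=
  ∃ i' κ fields vs lps,
    ((i', N, κ, fields) : Row) ∈ μ ∧ ((L, vs) : Label × List StoredVal) ∈ fields ∧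
    StoredVal.ref i lps ∈ vs ∧
    w = Value.ref i' (lps.map fun p => (p.1, Visibility.invisible, p.2.map Value.scalar))

/-- `res` enumerates the set `seek(μ, N, L, id)` as a sequence. -/
def Seek (μ : Store) (N : TyName) (L : Label) (i : Ident) (res : List Value) : Prop :=
  res.Nodup ∧ ∀ w, w ∈ res ↔ SeekMatches μ N L i w

/-- Per-value backlink seeking: the value must be a reference value. -/
def SeekVal (μ : Store) (N : TyName) (L : Label) (w : Value) (res : List Value) : Prop :=
  ∃ i entries, w = Value.ref i entries ∧ Seek μ N L i res

/-- Interpretations `⟦f⟧` of the built-in functions, as a relation. -/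
inductive FnEval : Fn → List (List Value) → List Value → Prop where
  | count {ws} : FnEval .count [ws] [Value.scalar (.vint ws.length)]
  | eq_true {w} : FnEval .eq [[w], [w]] [Value.scalar (.vbool true)]
  | eq_false {w₁ w₂} : w₁ ≠ w₂ → FnEval .eq [[w₁], [w₂]] [Value.scalar (.vbool false)]
  | any_true {ws} : Value.scalar (.vbool true) ∈ ws → FnEval .any [ws] [Value.scalar (.vbool true)]
  | any_false {ws} : Value.scalar (.vbool true) ∉ ws → FnEval .any [ws] [Value.scalar (.vbool false)]

/-- An ordering on computed values used for sorting keys. -/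
def Value.le : Value → Value → Prop
  | .scalar (.vint a), .scalar (.vint b) => a ≤ b
  | .scalar (.vstr a), .scalar (.vstr b) => a ≤ b
  | .scalar (.vbool a), .scalar (.vbool b) => a ≤ b
  | _, _ => True

/-- Comparison of sort keys (sequences of length zero or one); empty sequences are
smaller than nonempty ones. -/
def KeyLE : List Value → List Value → Prop
  | [], _ => True
  | _ :: _, [] => False
  | a :: _, b :: _ => Value.le a b

/-- `sort`: `out` lists the first components of `pairs`, reordered so that the second
components (the keys) are in nondecreasing order. -/
def SortRel (pairs : List (Value × List Value)) (out : List Value) : Prop :=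
  ∃ l : List (Value × List Value),
    l.Perm pairs ∧ l.Chain' (fun a b => KeyLE a.2 b.2) ∧ out = l.map Prod.fst

/-! ## Dynamic semantics -/

mutual
/-- The big-step evaluation judgment `Ω ∥ μ1 ⇒ μ2 ⊢_{Δ,μ_init} e ⇓ W̄`. -/
inductive Eval : Schema → Store → Env → Store → Expr → Store → List Value → Prop where
  | var {Δ μi} {Ω : Env} {μ x ws} :
      Ω.lookup x = some ws → Eval Δ μi Ω μ (.var x) μ ws
  | prim {Δ μi Ω μ v} : Eval Δ μi Ω μ (.prim v) μ [Value.scalar v]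
  | emp {Δ μi Ω μ τ} : Eval Δ μi Ω μ (.empty τ) μ []
  | union {Δ μi Ω μa μb μc e₁ e₂ ws₁ ws₂ ws} :
      Eval Δ μi Ω μa e₁ μb ws₁ → Eval Δ μi Ω μb e₂ μc ws₂ →
      (ws₁ ++ ws₂).Perm ws →
      Eval Δ μi Ω μa (.union e₁ e₂) μc ws
  | name {Δ} {μi : Store} {Ω μ N ws} :
      ws.Perm (((μi.rows.filter fun r => r.2.1 = N).toList).map fun r => Value.ref r.1 []) →
      Eval Δ μi Ω μ (.name N) μ ws
  | proj {Δ μi Ω μa μb e L ws wss wb} :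
      Eval Δ μi Ω μa e μb ws →
      List.Forall₂ (Project μi L) ws wss →
      wb.Perm wss.flatten →
      Eval Δ μi Ω μa (.proj e L) μb wb
  | backlink {Δ μi Ω μa μb e L N ws wss wb} :
      Eval Δ μi Ω μa e μb ws →
      List.Forall₂ (SeekVal μi N L) ws wss →
      wb.Perm wss.flatten →
      Eval Δ μi Ω μa (.backlink e L N) μb wb
  | shaping {Δ μi Ω μ₀ μ₁ μ₂ e x ents ws wsss} :
      Eval Δ μi Ω μ₀ e μ₁ ws →
      EvalShapeIter Δ μi Ω x μ₁ ws ents μ₂ wsss →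
      Eval Δ μi Ω μ₀ (.shaping e x ents) μ₂
        (List.zipWith (fun w wss => Value.extend w (List.zip (ents.map Prod.fst) wss)) ws wsss)
  | app {Δ μi Ω μ₁ μ₂ f es wss ws' ws} :
      EvalArgs Δ μi Ω μ₁ es μ₂ wss →
      FnEval f wss ws' → ws'.Perm ws →
      Eval Δ μi Ω μ₁ (.app f es) μ₂ ws
  | ite_true {Δ μi Ω μa μb μc e et ef ws} :
      Eval Δ μi Ω μa e μb [Value.scalar (.vbool true)] →
      Eval Δ μi Ω μb et μc ws →
      Eval Δ μi Ω μa (.ite e et ef) μc ws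
  | ite_false {Δ μi Ω μa μb μc e et ef ws} :
      Eval Δ μi Ω μa e μb [Value.scalar (.vbool false)] →
      Eval Δ μi Ω μb ef μc ws →
      Eval Δ μi Ω μa (.ite e et ef) μc ws
  | withE {Δ μi Ω μa μb μc e₁ x e₂ ws₁ ws₂} :
      Eval Δ μi Ω μa e₁ μb ws₁ →
      Eval Δ μi ((x, ws₁) :: Ω) μb e₂ μc ws₂ →
      Eval Δ μi Ω μa (.withE e₁ x e₂) μc ws₂
  | forE {Δ μi Ω μ₀ μ₁ μ₂ e x e' ws wss ws'} :
      Eval Δ μi Ω μ₀ e μ₁ ws →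
      EvalIter Δ μi Ω x μ₁ ws e' μ₂ wss →
      ws'.Perm wss.flatten →
      Eval Δ μi Ω μ₀ (.forE e x e') μ₂ ws'
  | orderby {Δ μi Ω μ₀ μ₁ μ₂ e x e' ws wss out} :
      Eval Δ μi Ω μ₀ e μ₁ ws →
      EvalIter Δ μi Ω x μ₁ ws e' μ₂ wss →
      SortRel (ws.zip wss) out →
      Eval Δ μi Ω μ₀ (.orderby e x e') μ₂ out
  | insert {Δ : Schema} {μi : Store} {Ω μ₁ μ₂ N sfields ents wss vss i} {μ' : Store} :
      Δ.lookup N = some sfields →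
      ents.map Prod.fst = sfields.map (fun f => f.1) →
      EvalArgs Δ μi Ω μ₁ (ents.map Prod.snd) μ₂ wss →
      wss.length = sfields.length → wss.length = vss.length →
      (∀ p ∈ (wss.zip sfields).zip vss, StripSeq p.1.1 p.1.2.2.1 p.2) →
      (∀ r ∈ μi, r.1 ≠ i) → (∀ r ∈ μ₂, r.1 ≠ i) →
      μ'.rows = insert ((i, N, EditMark.locked, List.zip (ents.map Prod.fst) vss) : Row) μ₂.rows →
      Eval Δ μi Ω μ₁ (.insert N ents) μ'
        [Value.ref i (List.zipWith
          (fun (en : Label × Expr) ws => (en.1, Visibility.invisible, ws)) ents wss)]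
  | update_skip {Δ μi Ω μ₀ μ₁ μ₂ e x ents i entries wss} :
      Eval Δ μi Ω μ₀ e μ₁ [Value.ref i entries] →
      EvalArgs Δ μi ((x, [Value.ref i entries]) :: Ω) μ₁ (ents.map Prod.snd) μ₂ wss →
      ((∀ r ∈ μ₂, r.1 ≠ i) ∨
        ∃ N fields, ((i, N, EditMark.locked, fields) : Row) ∈ μ₂) →
      Eval Δ μi Ω μ₀ (.update e x ents) μ₂ []
  | update_do {Δ : Schema} {μi Ω μ₀ μ₁ μ₂ e x ents i entries wss N oldfields sfields Ts vss}
      {μ' : Store} :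
      Eval Δ μi Ω μ₀ e μ₁ [Value.ref i entries] →
      EvalArgs Δ μi ((x, [Value.ref i entries]) :: Ω) μ₁ (ents.map Prod.snd) μ₂ wss →
      ((i, N, EditMark.unlocked, oldfields) : Row) ∈ μ₂ →
      Δ.lookup N = some sfields →
      ents.length = Ts.length → wss.length = vss.length → wss.length = ents.length →
      (∀ p ∈ ents.zip Ts, ∃ m, ((p.1.1, p.2, m) : Label × StoredTy × Card) ∈ sfields) →
      (∀ p ∈ (wss.zip Ts).zip vss, StripSeq p.1.1 p.1.2 p.2) →
      μ'.rows = insert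
        ((i, N, EditMark.locked,
          (oldfields.filter fun f => decide (f.1 ∉ ents.map Prod.fst)) ++
            List.zip (ents.map Prod.fst) vss) : Row)
        (μ₂.rows.erase (i, N, EditMark.unlocked, oldfields)) →
      Eval Δ μi Ω μ₀ (.update e x ents) μ'
        [Value.ref i (List.zipWith
          (fun (en : Label × Expr) ws => (en.1, Visibility.invisible, ws)) ents wss)]

/-- Sequential left-to-right evaluation of a list of expressions, threading the store. -/
inductive EvalArgs : Schema → Store → Env → Store → List Expr → Store → List (List Value) → Prop where
  | nil {Δ μi Ω μ} : EvalArgs Δ μi Ω μ [] μ []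
  | cons {Δ μi Ω μ₁ μ₂ μ₃ e es ws wss} :
      Eval Δ μi Ω μ₁ e μ₂ ws → EvalArgs Δ μi Ω μ₂ es μ₃ wss →
      EvalArgs Δ μi Ω μ₁ (e :: es) μ₃ (ws :: wss)

/-- Iterated evaluation of an expression, once per value of a sequence, with the
variable bound to the singleton of that value, threading the store. -/
inductive EvalIter : Schema → Store → Env → Var → Store → List Value → Expr → Store → List (List Value) → Prop where
  | nil {Δ μi Ω x μ e} : EvalIter Δ μi Ω x μ [] e μ []
  | cons {Δ μi Ω x μ₁ μ₂ μ₃ w wrest e ws wss} :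
      Eval Δ μi ((x, [w]) :: Ω) μ₁ e μ₂ ws →
      EvalIter Δ μi Ω x μ₂ wrest e μ₃ wss →
      EvalIter Δ μi Ω x μ₁ (w :: wrest) e μ₃ (ws :: wss)

/-- Iterated evaluation of the expressions of a shape, once per value of a sequence,
with the variable bound to the singleton of that value, threading the store. -/
inductive EvalShapeIter : Schema → Store → Env → Var → Store → List Value → List (Label × Expr) → Store → List (List (List Value)) → Prop where
  | nil {Δ μi Ω x μ ents} : EvalShapeIter Δ μi Ω x μ [] ents μ []
  | cons {Δ μi Ω x μ₁ μ₂ μ₃ w wrest ents wss wsss} :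
      EvalArgs Δ μi ((x, [w]) :: Ω) μ₁ (ents.map Prod.snd) μ₂ wss →
      EvalShapeIter Δ μi Ω x μ₂ wrest ents μ₃ wsss →
      EvalShapeIter Δ μi Ω x μ₁ (w :: wrest) ents μ₃ (wss :: wsss)
end

theorem Store.Extends.locked_aux {μ₂ μ₁ : Store} (h : μ₂.Extends μ₁) {i N f}
    (hr : ((i, N, EditMark.locked, f) : Row) ∈ μ₁) :
    ∃ f', ((i, N, EditMark.locked, f') : Row) ∈ μ₂ := by
  obtain ⟨⟨i', N', κ, f'⟩, hr', h1, h2⟩ := h.1 _ hr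
  simp only at h1 h2
  subst h1 h2
  cases κ with
  | locked => exact ⟨f', hr'⟩
  | unlocked =>
    have h3 := μ₁.uniq _ (h.2 _ hr' rfl) _ hr rfl
    simp at h3

theorem VTypedSeq.extends_aux {Δ μi μ₁ ws τ m} (h : VTypedSeq Δ μi μ₁ ws τ m) :
    ∀ μ₂ : Store, μ₂.Extends μ₁ → VTypedSeq Δ μi μ₂ ws τ m := by
  refine VTypedSeq.rec
    (motive_1 := fun w τ _ => ∀ μ₂ : Store, μ₂.Extends μ₁ → VTyped Δ μi μ₂ w τ)
    (motive_2 := fun ws τ m _ => ∀ μ₂ : Store, μ₂.Extends μ₁ → VTypedSeq Δ μi μ₂ ws τ m)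
    ?_ ?_ ?_ ?_ h
  · intros; exact .prim
  · intro _ _ _ _ _ _ h1 h2 h3 _ ih μ₂ hx
    exact .storedRef h1 h2 h3 (fun p hp => ih p hp μ₂ hx)
  · intro _ _ _ _ _ _ h1 h2 h3 h4 h5 _ ih μ₂ hx
    obtain ⟨f', hf⟩ := hx.locked_aux h3
    exact .newRef h1 h2 hf h4 h5 (fun p hp => ih p hp μ₂ hx)
  · intro _ _ _ h1 h2 _ ih μ₂ hx
    exact .set h1 h2 (fun w hw => ih w hw μ₂ hx)

theorem VTyped.extends_aux {Δ μi μ₁ w τ} (h : VTyped Δ μi μ₁ w τ)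
    (μ₂ : Store) (hx : μ₂.Extends μ₁) : VTyped Δ μi μ₂ w τ := by
  have h1 : VTypedSeq Δ μi μ₁ [w] τ Card.one :=
    .set (by simp [Card.one]) (by simp [Card.one]) (by simpa using h)
  cases h1.extends_aux μ₂ hx with
  | set _ _ h2 => exact h2 w (by simp)

/-! ## Statement 6: Extension preserves value typing -/

/-- If `μ2` extends `μ1`, then (1) computed-value typing, (2) computed-value sequence
typing, (3) environment typing, and (4) stored-value sequence typing are all preserved
when passing from `μ1` to `μ2`. -/
theorem extends_preserves_typing {μ₁ μ₂ : Store} (hext : μ₂.Extends μ₁) :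
    (∀ (Δ : Schema) (μinit : Store) (w : Value) (τ : Ty),
      VTyped Δ μinit μ₁ w τ → VTyped Δ μinit μ₂ w τ) ∧
    (∀ (Δ : Schema) (μinit : Store) (ws : List Value) (τ : Ty) (m : Card),
      VTypedSeq Δ μinit μ₁ ws τ m → VTypedSeq Δ μinit μ₂ ws τ m) ∧
    (∀ (Δ : Schema) (μinit : Store) (Ω : Env) (Γ : Ctx),
      EnvTyped Δ μinit μ₁ Ω Γ → EnvTyped Δ μinit μ₂ Ω Γ) ∧
    (∀ (Δ : Schema) (vs : List StoredVal) (T : StoredTy) (m : Card),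
      STypedSeq Δ μ₁ vs T m → STypedSeq Δ μ₂ vs T m) := by
  refine ⟨fun _ _ _ _ h => h.extends_aux _ hext, fun _ _ _ _ _ h => h.extends_aux _ hext,
    fun _ _ _ _ h => ⟨h.1, fun x ws τ m h1 h2 => (h.2 x ws τ m h1 h2).extends_aux _ hext⟩,
    fun _ _ _ _ h => ⟨h.1, h.2.1, fun v hv => ?_⟩⟩
  cases h.2.2 v hv with
  | prim => exact .prim
  | ref h1 h2 h3 =>
    obtain ⟨⟨i', N', κ, f'⟩, hr', e1, e2⟩ := hext.1 _ h1
    simp only at e1 e2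
    subst e1 e2
    exact .ref hr' h2 h3
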